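/- Let 0 < z < 1. For τ ∈ (0, π) define σ(τ) = arccosh(τ/(z·sin τ)), ρ = arccosh(1/z) − √(1 − z²), and ψ(τ) = σ(τ) − z·sinh(σ(τ))·cos τ − ρ. Then lim_{τ → 0⁺} ψ(τ)/τ² = (1/2)·√(1 − z²). -/

import Mathlib

open Real Filter

/-- arccosh x = log(x + √(x² − 1)) for x ≥ 1. -/
noncomputable def arccosh (x : ℝ) : ℝ := Real.log (x + Real.sqrt (x^2 - 1))

open Asymptotics Topology

theorem arccosh_eq_arcosh : arccosh = Real.arcosh := rfl

/-- The ratio `τ / sin τ` is `1 + O(τ²)` at the origin from the right. -/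
theorem div_sin_sub_one_isBigO :
    (fun τ : ℝ => τ / Real.sin τ - 1) =O[𝓝[>] 0] fun τ => τ ^ 2 := by
  refine IsBigO.of_bound 1 ?_
  filter_upwards [Ioo_mem_nhdsGT (zero_lt_one' ℝ)] with τ ⟨hpos, hlt⟩
  have hlow := Real.sin_gt_sub_cube hpos
  have hup := Real.sin_lt hpos
  have hsq : τ ^ 2 < 1 := by nlinarith
  have hsin : 3 / 4 * τ < Real.sin τ := by nlinarith
  have hsin_pos : 0 < Real.sin τ := by linarith
  have heq : τ / Real.sin τ - 1 = (τ - Real.sin τ) / Real.sin τ := by field_simp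
  rw [heq, norm_of_nonneg (div_nonneg (by linarith) hsin_pos.le),
    norm_of_nonneg (sq_nonneg τ), div_le_iff₀ hsin_pos]
  nlinarith [mul_lt_mul_of_pos_left hsin (pow_pos hpos 2), pow_pos hpos 3]

theorem tendsto_one_sub_cos_div_sq :
    Tendsto (fun τ : ℝ => (1 - Real.cos τ) / τ ^ 2) (𝓝[>] 0) (𝓝 (1 / 2)) := by
  have hsinc : Tendsto (fun τ : ℝ => Real.sinc (τ / 2) ^ 2 / 2) (𝓝[>] 0) (𝓝 (1 / 2)) := by
    have hcont : Continuous fun τ : ℝ => Real.sinc (τ / 2) ^ 2 / 2 :=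
      ((Real.continuous_sinc.comp (continuous_id.div_const 2)).pow 2).div_const 2
    simpa using (hcont.tendsto 0).mono_left nhdsWithin_le_nhds
  refine hsinc.congr' ?_
  filter_upwards [self_mem_nhdsWithin] with τ (hτ : 0 < τ)
  have hcos : Real.cos τ = 1 - 2 * Real.sin (τ / 2) ^ 2 := by
    rw [← Real.cos_sq_add_sin_sq (τ / 2), show τ = 2 * (τ / 2) by ring, Real.cos_two_mul']
    ring_nf
  rw [Real.sinc_of_ne_zero (by positivity), hcos]
  field_simp
  ring

/-- The saddle-point condition: `arcosh x - z √(x² - 1)` is stationary at `x = 1 / z`. -/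
theorem hasDerivAt_arcosh_sub_mul_sqrt {z : ℝ} (h0 : 0 < z) (h1 : z < 1) :
    HasDerivAt (fun x => Real.arcosh x - z * √(x ^ 2 - 1)) 0 (1 / z) := by
  have hx : 1 < 1 / z := (one_lt_div h0).2 h1
  have hpos : 0 < (1 / z) ^ 2 - 1 := by nlinarith
  have hsqrt := ((((hasDerivAt_id (1 / z)).pow 2).sub_const 1).sqrt hpos.ne').const_mul z
  refine ((Real.hasDerivAt_arcosh hx).sub hsqrt).congr_deriv ?_
  have hne := (Real.sqrt_pos.2 hpos).ne'
  simp only [id, Pi.pow_apply]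
  push_cast
  field_simp
  simp

/-- For 0 < z < 1, the Bessel phase ψ(τ) = σ(τ) − z sinh(σ(τ)) cos τ − ρ with
σ(τ) = arccosh(τ/(z sin τ)) and ρ = arccosh(1/z) − √(1−z²) satisfies
ψ(τ)/τ² → (1/2)√(1−z²) as τ → 0⁺. -/
theorem bessel_phase_quadratic_limit (z : ℝ) (h0 : 0 < z) (h1 : z < 1) :
    Tendsto (fun τ : ℝ =>
        (arccosh (τ / (z * Real.sin τ))
          - z * Real.sinh (arccosh (τ / (z * Real.sin τ))) * Real.cos τ
          - (arccosh (1/z) - Real.sqrt (1 - z^2))) / τ^2)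
      (nhdsWithin 0 (Set.Ioi 0)) (nhds ((1/2) * Real.sqrt (1 - z^2))) := by
  rw [arccosh_eq_arcosh]
  have hx : 1 < 1 / z := (one_lt_div h0).2 h1
  have hsqrt : z * √((1 / z) ^ 2 - 1) = √(1 - z ^ 2) := by
    rw [show 1 - z ^ 2 = z ^ 2 * ((1 / z) ^ 2 - 1) by field_simp,
      Real.sqrt_mul (sq_nonneg z), Real.sqrt_sq h0.le]
  have hO : (fun τ : ℝ => τ / (z * Real.sin τ) - 1 / z) =O[𝓝[>] 0] fun τ => τ ^ 2 := by
    refine (div_sin_sub_one_isBigO.const_mul_left (1 / z)).congr_left fun τ => ?_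
    rw [mul_comm z, ← div_div]
    ring
  have hu : Tendsto (fun τ : ℝ => τ / (z * Real.sin τ)) (𝓝[>] 0) (𝓝 (1 / z)) := by
    refine tendsto_sub_nhds_zero_iff.1 (hO.trans_tendsto ?_)
    simpa using ((continuous_pow 2).tendsto (0 : ℝ)).mono_left nhdsWithin_le_nhds
  have hstat := (hasDerivAt_iff_isLittleO.1 (hasDerivAt_arcosh_sub_mul_sqrt h0 h1)).comp_tendsto hu
  have hmain := (hstat.trans_isBigO hO).tendsto_div_nhds_zero
  have hcoef : Tendsto (fun τ : ℝ => z * √((τ / (z * Real.sin τ)) ^ 2 - 1))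
      (𝓝[>] 0) (𝓝 √(1 - z ^ 2)) := by
    rw [← hsqrt]
    exact (((hu.pow 2).sub_const 1).sqrt).const_mul z
  have hsum := hmain.add (hcoef.mul tendsto_one_sub_cos_div_sq)
  rw [zero_add, mul_comm (√(1 - z ^ 2))] at hsum
  refine hsum.congr' ?_
  filter_upwards [hu.eventually (lt_mem_nhds hx)] with τ hτ
  simp only [Function.comp_apply, smul_zero, sub_zero]
  rw [Real.sinh_arcosh hτ.le, hsqrt]
  ring
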